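/- The W-type distribution on three binary variables, defined by P(a,b,c) = 1/3 if a + b + c = 1 and P(a,b,c) = 0 otherwise, is not compatible with the Triangle scenario. -/

import Mathlib

open scoped BigOperators NNReal

/-- Compatibility of a distribution on `{0,1}³` with the Triangle causal scenario:
there are latent variables `X`, `Y`, `Z` with probability mass functions, and conditional
distributions for each observed node given its two latent parents, reproducing `P`. -/
def TriangleCompatible (P : Fin 2 → Fin 2 → Fin 2 → ℝ) : Prop :=
  ∃ (X Y Z : Type) (μX : X → ℝ≥0) (μY : Y → ℝ≥0) (μZ : Z → ℝ≥0)
    (qA : Y × Z → Fin 2 → ℝ≥0) (qB : X × Z → Fin 2 → ℝ≥0) (qC : X × Y → Fin 2 → ℝ≥0),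
    (∑' x, μX x) = 1 ∧ (∑' y, μY y) = 1 ∧ (∑' z, μZ z) = 1 ∧
    (∀ yz, ∑ a, qA yz a = 1) ∧
    (∀ xz, ∑ b, qB xz b = 1) ∧
    (∀ xy, ∑ c, qC xy c = 1) ∧
    ∀ a b c, P a b c =
      ((∑' (x : X) (y : Y) (z : Z),
        μX x * μY y * μZ z * qA (y, z) a * qB (x, z) b * qC (x, y) c : ℝ≥0) : ℝ)

/-- A probability mass function is summable. -/
lemma summable_of_tsum_eq_one {ι : Type*} {μ : ι → ℝ≥0} (hμ : ∑' i, μ i = 1) : Summable μ := by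
  by_contra hn
  simp [tsum_eq_zero_of_not_summable hn] at hμ

/-- The mean of a function bounded by `1` is at most `1`. -/
lemma tsum_mul_le_one {ι : Type*} {μ g : ι → ℝ≥0} (hμ : ∑' i, μ i = 1) (hg : ∀ i, g i ≤ 1) :
    ∑' i, μ i * g i ≤ 1 := by
  have hs := summable_of_tsum_eq_one hμ
  have hle : ∀ i, μ i * g i ≤ μ i := fun i => mul_le_of_le_one_right zero_le (hg i)
  exact ((NNReal.summable_of_le hle hs).tsum_le_tsum hle hs).trans_eq hμ

/-- A function bounded by `1` with mean zero vanishes wherever the mass is positive. -/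
lemma eq_zero_of_tsum_mul_eq_zero {ι : Type*} {μ g : ι → ℝ≥0} (hμ : ∑' i, μ i = 1)
    (hg : ∀ i, g i ≤ 1) (h : ∑' i, μ i * g i = 0) {i : ι} (hi : μ i ≠ 0) : g i = 0 := by
  have hle : ∀ i, μ i * g i ≤ μ i := fun i => mul_le_of_le_one_right zero_le (hg i)
  have hs := NNReal.summable_of_le hle (summable_of_tsum_eq_one hμ)
  exact (mul_eq_zero.1 (hs.tsum_eq_zero_iff.1 h i)).resolve_left hi

/-- A function of three independent variables, bounded by `1` and with mean zero, vanishes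
wherever the mass is positive. -/
lemma eq_zero_of_tsum_tsum_tsum_mul_eq_zero {X Y Z : Type*} {μX : X → ℝ≥0} {μY : Y → ℝ≥0}
    {μZ : Z → ℝ≥0} {w : X → Y → Z → ℝ≥0} (hX : ∑' x, μX x = 1) (hY : ∑' y, μY y = 1)
    (hZ : ∑' z, μZ z = 1) (hw : ∀ x y z, w x y z ≤ 1)
    (h : ∑' (x : X) (y : Y) (z : Z), μX x * μY y * μZ z * w x y z = 0)
    {x : X} {y : Y} {z : Z} (hx : μX x ≠ 0) (hy : μY y ≠ 0) (hz : μZ z ≠ 0) : w x y z = 0 := by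
  simp only [mul_assoc, NNReal.tsum_mul_left] at h
  have hZ1 : ∀ x y, ∑' z, μZ z * w x y z ≤ 1 := fun x y => tsum_mul_le_one hZ (hw x y)
  have hY1 : ∀ x, ∑' y, μY y * ∑' z, μZ z * w x y z ≤ 1 := fun x => tsum_mul_le_one hY (hZ1 x)
  exact eq_zero_of_tsum_mul_eq_zero hZ (hw x y)
    (eq_zero_of_tsum_mul_eq_zero hY (hZ1 x) (eq_zero_of_tsum_mul_eq_zero hX hY1 h hx) hy) hz

/-- Three relations, one for each pair of variables, such that exactly one of them holds at every
triple cannot all be inhabited. -/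
lemma not_exactly_one_of_pairwise {X Y Z : Type*} {A : Y → Z → Prop} {B : X → Z → Prop}
    {C : X → Y → Prop} (hABC : ∀ x y z, A y z ∨ B x z ∨ C x y)
    (hAB : ∀ x y z, A y z → ¬ B x z) (hAC : ∀ x y z, A y z → ¬ C x y)
    (hBC : ∀ x y z, B x z → ¬ C x y) {y₁ : Y} {z₁ : Z} (hA : A y₁ z₁)
    {x₂ : X} {z₂ : Z} (hB : B x₂ z₂) {x₃ : X} {y₃ : Y} (hC : C x₃ y₃) : False := by
  -- `C x₂ y₃` is excluded by `hB` and `B x₂ z₁` by `hA`, so `A y₃ z₁` holds, against `hC`.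
  rcases hABC x₂ y₃ z₁ with h | h | h
  · exact hAC x₃ y₃ z₁ h hC
  · exact hAB x₂ y₁ z₁ hA h
  · exact hBC x₂ y₃ z₂ hB h

/-- The W-type distribution on three binary variables
(`P(a,b,c) = 1/3` if `a + b + c = 1`, else `0`) is not compatible with the Triangle
scenario. -/
theorem w_distribution_not_triangle_compatible :
    ¬ TriangleCompatible
        (fun a b c => if (a : ℕ) + (b : ℕ) + (c : ℕ) = 1 then (1 : ℝ) / 3 else 0) := by
  rintro ⟨X, Y, Z, μX, μY, μZ, qA, qB, qC, hX, hY, hZ, hqA, hqB, hqC, hP⟩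
  have le_one : ∀ {p : Fin 2 → ℝ≥0}, ∑ i, p i = 1 → ∀ i, p i ≤ 1 := fun {p} hp i =>
    hp ▸ Finset.single_le_sum (fun _ _ => zero_le) (Finset.mem_univ i)
  have pos_or : ∀ {p : Fin 2 → ℝ≥0}, ∑ i, p i = 1 → p 0 ≠ 0 ∨ p 1 ≠ 0 := by
    intro p hp
    by_contra! h
    simp [Fin.sum_univ_two, h.1, h.2] at hp
  -- On the support of the sources, an outcome of probability zero has a vanishing factor.
  have impossible : ∀ a b c : Fin 2, (a : ℕ) + b + c ≠ 1 → ∀ {x y z}, μX x ≠ 0 → μY y ≠ 0 →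
      μZ z ≠ 0 → qA (y, z) a = 0 ∨ qB (x, z) b = 0 ∨ qC (x, y) c = 0 := by
    intro a b c habc x y z hx hy hz
    have h := hP a b c
    rw [eq_comm] at h
    simp only [if_neg habc, NNReal.coe_eq_zero] at h
    have := eq_zero_of_tsum_tsum_tsum_mul_eq_zero
      (w := fun x y z => qA (y, z) a * qB (x, z) b * qC (x, y) c) hX hY hZ
      (fun x y z => mul_le_one' (mul_le_one' (le_one (hqA _) _) (le_one (hqB _) _))
        (le_one (hqC _) _)) (by simpa only [mul_assoc] using h) hx hy hz
    simpa [or_assoc] using this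
  have possible : ∀ a b c : Fin 2, (a : ℕ) + b + c = 1 → ∃ x y z, μX x ≠ 0 ∧ μY y ≠ 0 ∧
      μZ z ≠ 0 ∧ qA (y, z) a ≠ 0 ∧ qB (x, z) b ≠ 0 ∧ qC (x, y) c ≠ 0 := by
    intro a b c habc
    by_contra! hn
    have h := hP a b c
    have hzero : ∀ x y z,
        μX x * μY y * μZ z * qA (y, z) a * qB (x, z) b * qC (x, y) c = 0 := by
      intro x y z
      simp only [mul_eq_zero]
      have := hn x y z
      tauto
    simp [habc, hzero] at h
  obtain ⟨-, y₁, z₁, -, hy₁, hz₁, hA, -, -⟩ := possible 1 0 0 rfl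
  obtain ⟨x₂, -, z₂, hx₂, -, hz₂, -, hB, -⟩ := possible 0 1 0 rfl
  obtain ⟨x₃, y₃, -, hx₃, hy₃, -, -, -, hC⟩ := possible 0 0 1 rfl
  refine not_exactly_one_of_pairwise (X := {x // μX x ≠ 0}) (Y := {y // μY y ≠ 0})
    (Z := {z // μZ z ≠ 0}) (A := fun y z => qA (y, z) 1 ≠ 0) (B := fun x z => qB (x, z) 1 ≠ 0)
    (C := fun x y => qC (x, y) 1 ≠ 0) ?_ ?_ ?_ ?_ (y₁ := ⟨y₁, hy₁⟩) (z₁ := ⟨z₁, hz₁⟩) hA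
    (x₂ := ⟨x₂, hx₂⟩) (z₂ := ⟨z₂, hz₂⟩) hB (x₃ := ⟨x₃, hx₃⟩) (y₃ := ⟨y₃, hy₃⟩) hC
  all_goals
    rintro ⟨x, hx⟩ ⟨y, hy⟩ ⟨z, hz⟩
    have hA01 := pos_or (hqA (y, z))
    have hB01 := pos_or (hqB (x, z))
    have hC01 := pos_or (hqC (x, y))
  · have := impossible 0 0 0 (by decide) hx hy hz
    tauto
  · have h0 := impossible 1 1 0 (by decide) hx hy hz
    have h1 := impossible 1 1 1 (by decide) hx hy hz
    tauto
  · have h0 := impossible 1 0 1 (by decide) hx hy hz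
    have h1 := impossible 1 1 1 (by decide) hx hy hz
    tauto
  · have h0 := impossible 0 1 1 (by decide) hx hy hz
    have h1 := impossible 1 1 1 (by decide) hx hy hz
    tauto
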